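/- For every integer m ≥ 1 and every v⋆ ∈ [0,r), sellers bid strictly more aggressively against the speculator than against a symmetric opponent: β(v; m, v⋆) < β̃(v; m, v⋆) for all v ∈ [v⋆, r), where β is the sellers' equilibrium bid function against the speculator and β̃ is the symmetric-benchmark bid function. -/

import Mathlib

open MeasureTheory Set

/-- Truncated conditional CDF `G(x; v⋆) = (F x − F v⋆)/(1 − F v⋆)`. -/
noncomputable def G (F : ℝ → ℝ) (vs x : ℝ) : ℝ := (F x - F vs) / (1 - F vs)

/-- `ubar_b(m, v⋆) = max_{b ∈ [v⋆, r]} b (1 − G(b; v⋆))^m`. -/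
noncomputable def ubarb (F : ℝ → ℝ) (r : ℝ) (m : ℕ) (vs : ℝ) : ℝ :=
  sSup ((fun b => b * (1 - G F vs b) ^ m) '' Icc vs r)

/-- `b̄(m, v⋆)`: the smallest maximizer of `b (1 − G(b; v⋆))^m` over `[v⋆, r]`. -/
noncomputable def bbar (F : ℝ → ℝ) (r : ℝ) (m : ℕ) (vs : ℝ) : ℝ :=
  sInf {b ∈ Icc vs r | b * (1 - G F vs b) ^ m = ubarb F r m vs}

/-- Sellers' equilibrium bid function against the speculator. -/
noncomputable def beta (F : ℝ → ℝ) (r : ℝ) (m : ℕ) (vs : ℝ) (v : ℝ) : ℝ :=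
  if v ≤ bbar F r m vs then ubarb F r m vs / (1 - G F vs v) ^ m else v

/-- Symmetric-benchmark bid function (as if the speculator were another seller). -/
noncomputable def betaTilde (F : ℝ → ℝ) (r : ℝ) (m : ℕ) (vs : ℝ) (v : ℝ) : ℝ :=
  if v ≤ r then v + (∫ x in v..r, (1 - G F vs x) ^ m) / (1 - G F vs v) ^ m else v

/-- Sellers bid strictly more aggressively against the speculator than against a
symmetric opponent. -/
theorem sellers_bid_more_aggressively_against_speculator
    (F f : ℝ → ℝ) (N : ℕ) (hN : 2 ≤ N)
    (hderiv : ∀ x ∈ Icc (0 : ℝ) 1, HasDerivAt F (f x) x)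
    (hfc : ContinuousOn f (Icc 0 1))
    (hfpos : ∀ x ∈ Ioo (0 : ℝ) 1, 0 < f x)
    (hF0 : F 0 = 0) (hF1 : F 1 = 1)
    (r : ℝ) (hr : r ∈ Ioc (0 : ℝ) 1)
    (m : ℕ) (hm : 1 ≤ m)
    (vs : ℝ) (hvs : vs ∈ Ico (0 : ℝ) r) (hFvs : F vs < 1) :
    ∀ v ∈ Ico vs r, beta F r m vs v < betaTilde F r m vs v := by
  intro v hv
  have hr1 : r ≤ 1 := hr.2
  have hvs0 : 0 ≤ vs := hvs.1
  have hFc : ContinuousOn F (Icc 0 1) := fun x hx =>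
    (hderiv x hx).continuousAt.continuousWithinAt
  have hFm : StrictMonoOn F (Icc 0 1) := by
    apply strictMonoOn_of_deriv_pos (convex_Icc 0 1) hFc
    intro x hx
    rw [interior_Icc] at hx
    rw [(hderiv x (Ioo_subset_Icc_self hx)).deriv]
    exact hfpos x hx
  have hd : 0 < 1 - F vs := by linarith
  have hH : ∀ x, 1 - G F vs x = (1 - F x) / (1 - F vs) := by
    intro x; unfold G; field_simp; ring
  obtain ⟨h, hh⟩ : ∃ h : ℝ → ℝ, h = fun x => (1 - G F vs x) ^ m := ⟨_, rfl⟩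
  have hhx : ∀ x, (1 - G F vs x) ^ m = h x := fun x => by rw [hh]
  have hanti : ∀ x y, vs ≤ x → x < y → y ≤ r → h y < h x := by
    intro x y hx hxy hy
    rw [← hhx, ← hhx, hH, hH]
    have h1 : F x < F y := hFm ⟨by linarith, by linarith⟩ ⟨by linarith, by linarith⟩ hxy
    have h2 : F y ≤ F 1 := hFm.monotoneOn ⟨by linarith, by linarith⟩ ⟨by norm_num, le_rfl⟩
      (by linarith)
    apply pow_lt_pow_left₀ _ _ (by omega)
    · apply div_lt_div_of_pos_right _ hd
      linarith
    · apply div_nonneg _ hd.le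
      linarith
  have hnn : ∀ x, vs ≤ x → x ≤ r → 0 ≤ h x := by
    intro x hx hy
    rw [← hhx, hH]
    have h2 : F x ≤ F 1 := hFm.monotoneOn ⟨by linarith, by linarith⟩ ⟨by norm_num, le_rfl⟩
      (by linarith)
    apply pow_nonneg
    apply div_nonneg _ hd.le
    linarith
  have hhc : ContinuousOn h (Icc vs r) := by
    rw [hh]
    simp only [hH]
    have : ContinuousOn F (Icc vs r) := hFc.mono (Icc_subset_Icc hvs0 hr1)
    fun_prop
  have hpos : 0 < h v := lt_of_le_of_lt (hnn r hvs.2.le le_rfl) (hanti v r hv.1 hv.2 le_rfl)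
  have hstrict : ∀ a b, vs ≤ a → a < b → b ≤ r → (b - a) * h b < ∫ x in a..b, h x := by
    intro a b ha hab hb
    have := intervalIntegral.integral_lt_integral_of_continuousOn_of_le_of_exists_lt
      (f := fun _ => h b) (g := h) hab continuousOn_const
      (hhc.mono (Icc_subset_Icc ha hb)) ?_ ⟨a, ⟨le_rfl, hab.le⟩, hanti a b ha hab hb⟩
    · simpa using this
    · intro x hx
      rcases hx.2.eq_or_lt with e | e
      · rw [e]
      · exact (hanti x b (by linarith [hx.1]) e hb).le
  have hint : 0 < ∫ x in v..r, h x := by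
    have h1 := hstrict v r hv.1 hv.2 le_rfl
    have h2 := mul_nonneg (sub_nonneg.2 hv.2.le) (hnn r hvs.2.le le_rfl)
    linarith
  unfold beta betaTilde
  rw [if_pos hv.2.le]
  simp only [hhx]
  split_ifs with hb
  swap
  · have := div_pos hint hpos
    linarith
  have hcont : ContinuousOn (fun b => b * h b) (Icc vs r) := continuousOn_id.mul hhc
  have hmem : bbar F r m vs ∈ {b ∈ Icc vs r | b * (1 - G F vs b) ^ m = ubarb F r m vs} := by
    apply IsClosed.csInf_mem
    · simp only [hhx]
      exact hcont.preimage_isClosed_of_isClosed isClosed_Icc isClosed_singleton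
    · obtain ⟨x, hx, hx2⟩ := isCompact_Icc.exists_sSup_image_eq
        (nonempty_Icc.2 hvs.2.le) hcont
      refine ⟨x, hx, ?_⟩
      unfold ubarb
      simp only [hhx]
      exact hx2.symm
    · exact ⟨vs, fun x hx => hx.1.1⟩
  obtain ⟨⟨hb1, hb2⟩, hb3⟩ := hmem
  rw [hhx] at hb3
  rw [← hb3]
  generalize bbar F r m vs = b at *
  rw [div_lt_iff₀ hpos, add_mul, div_mul_cancel₀ _ hpos.ne']
  rcases hb.eq_or_lt with e | e
  · rw [← e]; linarith
  · have h1 := hstrict v b hv.1 e hb2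
    have h2 := hanti v b hv.1 e hb2
    have hsplit := intervalIntegral.integral_add_adjacent_intervals (μ := volume)
      ((hhc.mono (Icc_subset_Icc hv.1 hb2)).intervalIntegrable_of_Icc hb)
      ((hhc.mono (Icc_subset_Icc hb1 le_rfl)).intervalIntegrable_of_Icc hb2)
    have h3 : 0 ≤ ∫ x in b..r, h x :=
      intervalIntegral.integral_nonneg hb2 (fun x hx => hnn x (hb1.trans hx.1) hx.2)
    have h4 : v * h b ≤ v * h v := mul_le_mul_of_nonneg_left h2.le (hvs0.trans hv.1)
    linarith
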